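/- arXiv:2504.20517 — 3 statements merged into one kernel-verified Lean document; each statement's English description precedes it below -/
import Mathlib

section
/- Coercivity of the penalized functional (step (c) of the second proof of Theorem 1.2): Let H be a separable real Hilbert space, (φ_n)_{n≥1} an orthonormal basis of H, (λ_n)_{n≥1} a sequence of real numbers, and T > 0 with Σ_{n≥1} exp(−2T λ_n) < ∞. Define K_T : H → H by K_T f = Σ_{n≥1} exp(−T λ_n) ⟨f, φ_n⟩ φ_n. Fix ε > 0 and h ∈ H and define J(f) = ½‖K_T f‖² + ε‖f‖ − ⟨h, f⟩. Then J is coercive: for every sequence (f_m)_{m≥1} in H with ‖f_m‖ → +∞ one has J(f_m) → +∞. -/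
open scoped RealInnerProductSpace

/-- The coefficients of `∑' n, (w n * ⟪f, φ n⟫) • φ n` in a Hilbert basis `φ`, for square-summable
weights `w`. -/
theorem HilbertBasis.inner_tsum_mul_inner_smul {ι H : Type*} [NormedAddCommGroup H]
    [InnerProductSpace ℝ H] [CompleteSpace H] (φ : HilbertBasis ι ℝ H) {w : ι → ℝ}
    (hw : Summable fun n => w n ^ 2) (f : H) (i : ι) :
    ⟪φ i, ∑' n, (w n * ⟪f, φ n⟫) • φ n⟫ = w i * ⟪f, φ i⟫ := by
  classical
  have hf : Summable fun n => ⟪f, φ n⟫ ^ 2 := by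
    simpa [real_inner_comm] using φ.orthonormal.inner_products_summable f
  have hsum : Summable fun n => (w n * ⟪f, φ n⟫) • φ n := by
    refine Summable.of_norm_bounded (hw.add hf) fun n => ?_
    rw [norm_smul, φ.orthonormal.1 n, mul_one, Real.norm_eq_abs, abs_le]
    constructor <;> nlinarith [sq_nonneg (w n + ⟪f, φ n⟫), sq_nonneg (w n - ⟪f, φ n⟫),
      sq_nonneg (w n), sq_nonneg ⟪f, φ n⟫]
  have key := (innerSL ℝ (φ i)).map_tsum hsum
  simp only [innerSL_apply_apply] at key
  rw [key, tsum_eq_single i]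
  · rw [inner_smul_right, real_inner_self_eq_norm_sq, φ.orthonormal.1 i]
    ring
  · intro n hn
    rw [inner_smul_right, φ.orthonormal.2 hn.symm, mul_zero]

/-- Coercivity of the penalized functional `J(f) = ½‖K_T f‖² + ε‖f‖ − ⟨h,f⟩`,
where `K_T f = Σ_n exp(−Tλ_n)⟨f,φ_n⟩φ_n` with `Σ exp(−2Tλ_n) < ∞`:
if `‖f_m‖ → ∞` then `J(f_m) → ∞`. -/
theorem stmt_4 {H : Type*} [NormedAddCommGroup H] [InnerProductSpace ℝ H]
    [CompleteSpace H] [TopologicalSpace.SeparableSpace H]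
    (φ : HilbertBasis ℕ ℝ H) (lam : ℕ → ℝ) (T : ℝ) (hT : 0 < T)
    (hsum : Summable (fun n => Real.exp (-2 * T * lam n)))
    (K : H → H)
    (hK : ∀ f, K f = ∑' n, (Real.exp (-T * lam n) * ⟪f, φ n⟫) • φ n)
    (ε : ℝ) (hε : 0 < ε) (h : H)
    (J : H → ℝ)
    (hJ : ∀ f, J f = (1 / 2) * ‖K f‖ ^ 2 + ε * ‖f‖ - ⟪h, f⟫)
    (f : ℕ → H)
    (hf : Filter.Tendsto (fun m => ‖f m‖) Filter.atTop Filter.atTop) :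
    Filter.Tendsto (fun m => J (f m)) Filter.atTop Filter.atTop := by
  have hw : Summable fun n => Real.exp (-T * lam n) ^ 2 := by
    convert hsum using 2 with n
    rw [← Real.exp_nat_mul]
    congr 1
    push_cast
    ring
  have hcoef (x : H) (n : ℕ) : ⟪φ n, K x⟫ = Real.exp (-T * lam n) * ⟪x, φ n⟫ := by
    rw [hK, φ.inner_tsum_mul_inner_smul hw]
  obtain ⟨s, hs⟩ : ∃ s : Finset ℕ, ‖h - ∑ n ∈ s, φ.repr h n • φ n‖ < ε / 2 := by
    obtain ⟨s, hs⟩ := ((φ.hasSum_repr h).eventually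
      (Metric.ball_mem_nhds h (half_pos hε))).exists
    exact ⟨s, by rwa [dist_comm, dist_eq_norm] at hs⟩
  set p : H := ∑ n ∈ s, φ.repr h n • φ n with hp
  set g : H := ∑ n ∈ s, (φ.repr h n * Real.exp (T * lam n)) • φ n with hg
  have hpg (x : H) : ⟪p, x⟫ = ⟪g, K x⟫ := by
    simp only [hp, hg, sum_inner, real_inner_smul_left]
    refine Finset.sum_congr rfl fun n _ => ?_
    have he : Real.exp (T * lam n) * Real.exp (-T * lam n) = 1 := by
      rw [← Real.exp_add]
      simp
    rw [hcoef, real_inner_comm]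
    linear_combination (-φ.repr h n * ⟪x, φ n⟫) * he
  have hbound (x : H) : ε / 2 * ‖x‖ - 1 / 2 * ‖g‖ ^ 2 ≤ J x := by
    have hsplit : ⟪h, x⟫ = ⟪h - p, x⟫ + ⟪g, K x⟫ := by
      rw [← hpg, inner_sub_left]
      ring
    have h1 : ⟪h - p, x⟫ ≤ ε / 2 * ‖x‖ :=
      (real_inner_le_norm _ _).trans (by gcongr)
    have h2 := real_inner_le_norm g (K x)
    rw [hJ]
    nlinarith [sq_nonneg (‖g‖ - ‖K x‖)]
  exact Filter.tendsto_atTop_mono (fun m => hbound (f m))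
    (Filter.tendsto_atTop_add_const_right _ (-(1 / 2 * ‖g‖ ^ 2))
      (hf.const_mul_atTop (half_pos hε)))
end

section
/- Existence of a minimizer for the penalized functional (direct method step of the second proof of Theorem 1.2): Let H be a separable real Hilbert space, (φ_n)_{n≥1} an orthonormal basis of H, (λ_n)_{n≥1} a sequence of real numbers, and T > 0 with Σ_{n≥1} exp(−2T λ_n) < ∞. Define K_T : H → H by K_T f = Σ_{n≥1} exp(−T λ_n) ⟨f, φ_n⟩ φ_n. Fix ε > 0 and h ∈ H and define J(f) = ½‖K_T f‖² + ε‖f‖ − ⟨h, f⟩. Then J attains its minimum on H: there exists f* ∈ H with J(f*) ≤ J(f) for all f ∈ H. -/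
open scoped RealInnerProductSpace

/-- Sublevel sets of `½‖K f‖² + ε‖f‖ - ⟨h, f⟩` are weakly closed: this functional is the supremum
of the weakly continuous affine functionals `f ↦ ⟨f, A y + z - h⟩ - ½‖y‖²` with `‖z‖ ≤ ε`. -/
lemma penalized_le_iff {H G : Type*} [NormedAddCommGroup H] [InnerProductSpace ℝ H]
    [NormedAddCommGroup G] [InnerProductSpace ℝ G] {K : H → G} {A : G → H}
    (hKA : ∀ f g, ⟪K f, g⟫ = ⟪f, A g⟫) {ε : ℝ} (hε : 0 ≤ ε) (h f : H) (c : ℝ) :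
    (1 / 2) * ‖K f‖ ^ 2 + ε * ‖f‖ - ⟪h, f⟫ ≤ c ↔
      ∀ y : G, ∀ z : H, ‖z‖ ≤ ε → ⟪f, A y + z - h⟫ - (1 / 2) * ‖y‖ ^ 2 ≤ c := by
  constructor
  · intro hc y z hz
    have h1 : ⟪f, z⟫ ≤ ε * ‖f‖ := by
      nlinarith [real_inner_le_norm f z, norm_nonneg f]
    have h2 := norm_sub_sq_real (K f) y
    have h3 := sq_nonneg ‖K f - y‖
    rw [inner_sub_right, inner_add_right, ← hKA, real_inner_comm h f]
    linarith
  · intro hc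
    have hz : ‖(ε * ‖f‖⁻¹) • f‖ ≤ ε := by
      rcases eq_or_ne f 0 with rfl | hf
      · simpa using hε
      · rw [norm_smul, norm_mul, norm_inv, norm_norm, Real.norm_of_nonneg hε, mul_assoc,
          inv_mul_cancel₀ (norm_ne_zero_iff.2 hf), mul_one]
    have h1 : ⟪f, (ε * ‖f‖⁻¹) • f⟫ = ε * ‖f‖ := by
      rw [real_inner_smul_right, real_inner_self_eq_norm_sq]
      rcases eq_or_ne f 0 with rfl | hf
      · simp
      · have := norm_ne_zero_iff.2 hf
        field_simp
    have h2 := hc (K f) _ hz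
    rw [inner_sub_right, inner_add_right, ← hKA, h1, real_inner_self_eq_norm_sq,
      real_inner_comm h f] at h2
    linarith

/-- If `K` has a formal adjoint `A` with dense range, then `½‖K f‖² + ε‖f‖ - ⟨h, f⟩` is coercive. -/
lemma exists_le_penalized {H G : Type*} [NormedAddCommGroup H] [InnerProductSpace ℝ H]
    [NormedAddCommGroup G] [InnerProductSpace ℝ G] {K : H → G} {A : G → H}
    (hKA : ∀ f g, ⟪K f, g⟫ = ⟪f, A g⟫) (hA : DenseRange A) {ε : ℝ} (hε : 0 < ε) (h : H) :
    ∃ C : ℝ, ∀ f : H,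
      ε / 2 * ‖f‖ - C ≤ (1 / 2) * ‖K f‖ ^ 2 + ε * ‖f‖ - ⟪h, f⟫ := by
  obtain ⟨w, hw⟩ := hA.exists_dist_lt h (half_pos hε)
  rw [dist_eq_norm] at hw
  refine ⟨(1 / 2) * ‖w‖ ^ 2, fun f => ?_⟩
  have h1 : ⟪h, f⟫ = ⟪K f, w⟫ + ⟪h - A w, f⟫ := by
    rw [hKA, inner_sub_left, real_inner_comm (A w) f]; ring
  have h2 : ⟪h - A w, f⟫ ≤ ε / 2 * ‖f‖ := by
    nlinarith [real_inner_le_norm (h - A w) f, norm_nonneg f]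
  have h3 := norm_sub_sq_real (K f) w
  have h4 := sq_nonneg ‖K f - w‖
  linarith

/-- If `K` has a formal adjoint with dense range, then `½‖K f‖² + ε‖f‖ - ⟨h, f⟩` attains its
minimum. -/
theorem exists_forall_penalized_le {H G : Type*} [NormedAddCommGroup H] [InnerProductSpace ℝ H]
    [CompleteSpace H] [NormedAddCommGroup G] [InnerProductSpace ℝ G] {K : H → G} {A : G → H}
    (hKA : ∀ f g, ⟪K f, g⟫ = ⟪f, A g⟫) (hA : DenseRange A) {ε : ℝ} (hε : 0 < ε) (h : H)
    {J : H → ℝ} (hJ : ∀ f, J f = (1 / 2) * ‖K f‖ ^ 2 + ε * ‖f‖ - ⟪h, f⟫) :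
    ∃ f₀ : H, ∀ f : H, J f₀ ≤ J f := by
  obtain ⟨C, hC⟩ := exists_le_penalized hKA hA hε h
  let e : WeakDual ℝ H → H := fun x =>
    (InnerProductSpace.toDual ℝ H).symm (WeakDual.toStrongDual x)
  have he : ∀ x g, ⟪e x, g⟫ = x g := fun x g => InnerProductSpace.toDual_symm_apply
  have hlsc : LowerSemicontinuous (J ∘ e) := by
    refine lowerSemicontinuous_iff_isClosed_preimage.2 fun c => ?_
    have : (J ∘ e) ⁻¹' Set.Iic c = ⋂ (y : G) (z : H) (_ : ‖z‖ ≤ ε),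
        {x : WeakDual ℝ H | x (A y + z - h) - (1 / 2) * ‖y‖ ^ 2 ≤ c} := by
      ext x
      simp only [Set.mem_preimage, Function.comp_apply, Set.mem_Iic, Set.mem_iInter,
        Set.mem_ofPred_eq, hJ, penalized_le_iff hKA hε.le, he]
    rw [this]
    exact isClosed_iInter fun y => isClosed_iInter fun z => isClosed_iInter fun _ =>
      isClosed_le ((WeakDual.eval_continuous _).sub continuous_const) continuous_const
  have hR : 0 ≤ 2 / ε * (J 0 + C) := by
    have := hC 0
    rw [← hJ, norm_zero, mul_zero] at this
    exact mul_nonneg (by positivity) (by linarith)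
  obtain ⟨x, -, hx⟩ := LowerSemicontinuousOn.exists_isMinOn
    (s := WeakDual.toStrongDual ⁻¹' Metric.closedBall (0 : StrongDual ℝ H) (2 / ε * (J 0 + C)))
    ⟨0, by simpa using hR⟩ (WeakDual.isCompact_closedBall _ _) (hlsc.lowerSemicontinuousOn _)
  have hmem : ∀ f : H, ‖f‖ ≤ 2 / ε * (J 0 + C) → J (e x) ≤ J f := fun f hf => by
    have := hx (a := StrongDual.toWeakDual (InnerProductSpace.toDual ℝ H f)) (by simpa using hf)
    simpa [e] using this
  refine ⟨e x, fun f => ?_⟩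
  by_cases hf : ‖f‖ ≤ 2 / ε * (J 0 + C)
  · exact hmem f hf
  · refine (hmem 0 (by simpa using hR)).trans ?_
    have h1 := hC f
    rw [← hJ] at h1
    have h2 : ε / 2 * (2 / ε * (J 0 + C)) ≤ ε / 2 * ‖f‖ := by
      gcongr
      exact (not_le.1 hf).le
    have h3 : ε / 2 * (2 / ε * (J 0 + C)) = J 0 + C := by field_simp
    linarith

/-- A diagonal operator with square-summable coefficients is defined by a convergent series. -/
lemma HilbertBasis.summable_diagonal {ι H : Type*} [NormedAddCommGroup H] [InnerProductSpace ℝ H]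
    [CompleteSpace H] (φ : HilbertBasis ι ℝ H) {μ : ι → ℝ} (hμ : Summable fun n => μ n ^ 2)
    (f : H) : Summable fun n => (μ n * ⟪f, φ n⟫) • φ n := by
  have hf : Summable fun n => ⟪f, φ n⟫ ^ 2 := by
    refine (φ.summable_inner_mul_inner f f).congr fun n => ?_
    rw [real_inner_comm f (φ n), sq]
  refine Summable.of_norm_bounded (hμ.add hf) fun n => ?_
  rw [norm_smul, φ.orthonormal.norm_eq_one, mul_one, Real.norm_eq_abs, abs_le]
  constructor <;> nlinarith [sq_nonneg (μ n + ⟪f, φ n⟫), sq_nonneg (μ n - ⟪f, φ n⟫),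
    sq_nonneg (μ n), sq_nonneg ⟪f, φ n⟫]

lemma HilbertBasis.inner_diagonal_comm {ι H : Type*} [NormedAddCommGroup H]
    [InnerProductSpace ℝ H] [CompleteSpace H] (φ : HilbertBasis ι ℝ H) {μ : ι → ℝ}
    (hμ : Summable fun n => μ n ^ 2) {K : H → H}
    (hK : ∀ f, K f = ∑' n, (μ n * ⟪f, φ n⟫) • φ n) (f g : H) : ⟪K f, g⟫ = ⟪f, K g⟫ := by
  have key : ∀ u v, ⟪u, K v⟫ = ∑' n, μ n * ⟪v, φ n⟫ * ⟪u, φ n⟫ := fun u v => by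
    rw [hK, ← innerSL_apply_apply (𝕜 := ℝ), (innerSL ℝ u).map_tsum (φ.summable_diagonal hμ v)]
    simp
  rw [real_inner_comm, key, key]
  exact tsum_congr fun n => by ring

lemma HilbertBasis.denseRange_diagonal {ι H : Type*} [NormedAddCommGroup H]
    [InnerProductSpace ℝ H] [CompleteSpace H] (φ : HilbertBasis ι ℝ H) {μ : ι → ℝ}
    (hμ : Summable fun n => μ n ^ 2) (hμ0 : ∀ n, μ n ≠ 0) {K : H → H}
    (hK : ∀ f, K f = ∑' n, (μ n * ⟪f, φ n⟫) • φ n) : DenseRange K := by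
  have hs := φ.inner_diagonal_comm hμ hK
  let L : H →ₗ[ℝ] H :=
    { toFun := K
      map_add' := fun f g => ext_inner_right ℝ fun v => by simp only [hs, inner_add_left]
      map_smul' := fun c f => ext_inner_right ℝ fun v => by
        simp only [hs, inner_smul_left, RingHom.id_apply] }
  have hφ : ∀ n, K (φ n) = μ n • φ n := fun n => by
    rw [hK, tsum_eq_single n fun m hm => by
      rw [φ.orthonormal.inner_eq_zero hm.symm, mul_zero, zero_smul]]
    rw [real_inner_self_eq_norm_sq, φ.orthonormal.norm_eq_one]
    simp
  have hspan : Submodule.span ℝ (Set.range φ) ≤ L.range := by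
    rw [Submodule.span_le]
    rintro _ ⟨n, rfl⟩
    refine ⟨(μ n)⁻¹ • φ n, ?_⟩
    rw [map_smul, show L (φ n) = μ n • φ n from hφ n, inv_smul_smul₀ (hμ0 n)]
  have hd := Submodule.dense_iff_topologicalClosure_eq_top.2 φ.dense_span
  exact hd.mono fun v hv => hspan hv

/-- Existence of a minimizer of the penalized functional
`J(f) = ½‖K_T f‖² + ε‖f‖ − ⟨h,f⟩`, where `K_T f = Σ_n exp(−Tλ_n)⟨f,φ_n⟩φ_n`
with `Σ exp(−2Tλ_n) < ∞`. -/
theorem stmt_6 {H : Type*} [NormedAddCommGroup H] [InnerProductSpace ℝ H]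
    [CompleteSpace H] [TopologicalSpace.SeparableSpace H]
    (φ : HilbertBasis ℕ ℝ H) (lam : ℕ → ℝ) (T : ℝ) (hT : 0 < T)
    (hsum : Summable (fun n => Real.exp (-2 * T * lam n)))
    (K : H → H)
    (hK : ∀ f, K f = ∑' n, (Real.exp (-T * lam n) * ⟪f, φ n⟫) • φ n)
    (ε : ℝ) (hε : 0 < ε) (h : H)
    (J : H → ℝ)
    (hJ : ∀ f, J f = (1 / 2) * ‖K f‖ ^ 2 + ε * ‖f‖ - ⟪h, f⟫) :
    ∃ fstar : H, ∀ f : H, J fstar ≤ J f := by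
  have hμ : Summable fun n => Real.exp (-T * lam n) ^ 2 := by
    refine hsum.congr fun n => ?_
    rw [← Real.exp_nat_mul]
    congr 1
    push_cast
    ring
  exact exists_forall_penalized_le (φ.inner_diagonal_comm hμ hK)
    (φ.denseRange_diagonal hμ (fun n => (Real.exp_pos _).ne') hK) hε h hJ
end

section
/- Approximation estimate from the minimizer (conclusion of the variational argument in the second proof of Theorem 1.2): Let H be a real Hilbert space, L : H → H a bounded self-adjoint linear operator, ε > 0 and h ∈ H, and define J(f) = ½‖L f‖² + ε‖f‖ − ⟨h, f⟩. Suppose f* ∈ H satisfies f* ≠ 0 and J(f*) ≤ J(f) for all f ∈ H. Then ‖L(L f*) − h‖ ≤ ε. -/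
open scoped RealInnerProductSpace

/-- A real number dominated by `t * M` for every positive `t` is nonpositive. -/
lemma nonpos_of_forall_pos_le_mul {c M : ℝ} (hM : 0 ≤ M) (hc : ∀ t : ℝ, 0 < t → c ≤ t * M) :
    c ≤ 0 := by
  by_contra! hpos
  have hlt : c / (M + 1) * M < c := by
    rw [div_mul_eq_mul_div, div_lt_iff₀ (by positivity)]
    nlinarith
  exact absurd (hc (c / (M + 1)) (by positivity)) (not_le.mpr hlt)

/-- Approximation estimate from a nonzero minimizer of
`J(f) = ½‖Lf‖² + ε‖f‖ − ⟨h,f⟩` for a bounded self-adjoint operator `L`: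
`‖L(Lf*) − h‖ ≤ ε`. -/
theorem stmt_8 {H : Type*} [NormedAddCommGroup H] [InnerProductSpace ℝ H]
    (L : H →L[ℝ] H) (hLsa : ∀ x y : H, ⟪L x, y⟫ = ⟪x, L y⟫)
    (ε : ℝ) (hε : 0 < ε) (h : H)
    (J : H → ℝ)
    (hJ : ∀ f, J f = (1 / 2) * ‖L f‖ ^ 2 + ε * ‖f‖ - ⟪h, f⟫)
    (fstar : H) (hfstar : fstar ≠ 0) (hmin : ∀ f, J fstar ≤ J f) :
    ‖L (L fstar) - h‖ ≤ ε := by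
  set r := L (L fstar) - h with hr
  have key : ‖r‖ ^ 2 - ε * ‖r‖ ≤ 0 := by
    refine nonpos_of_forall_pos_le_mul (M := (1 / 2) * ‖L r‖ ^ 2) (by positivity) fun t ht => ?_
    have hm := hmin (fstar - t • r)
    rw [hJ, hJ, map_sub, map_smul, norm_sub_sq_real, inner_sub_right, inner_smul_right,
      inner_smul_right, norm_smul, Real.norm_of_nonneg ht.le, ← hLsa] at hm
    have hn : ‖fstar - t • r‖ ≤ ‖fstar‖ + t * ‖r‖ := by
      simpa [norm_smul, abs_of_pos ht] using norm_sub_le fstar (t • r)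
    have hrr : ⟪L (L fstar), r⟫ - ⟪h, r⟫ = ‖r‖ ^ 2 := by
      rw [← inner_sub_left, ← hr, real_inner_self_eq_norm_sq]
    have hεn := mul_le_mul_of_nonneg_left hn hε.le
    refine le_of_mul_le_mul_left ?_ ht
    rw [← hrr]
    linarith
  by_contra! hlt
  nlinarith
end
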